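/- Let X and ι be types and let F : ι → (X → ℝ) be a family of functions that is linearly independent over ℝ. Let K, K̃ ∈ ℕ, let φ : Fin K → ι and ψ : Fin K̃ → ι be injective, let ω : Fin K → ℝ² and ω̃ : Fin K̃ → ℝ², and let T ⊆ ℝ contain at least two distinct elements. Suppose that for every t ∈ T and every x ∈ X, ∑_{r=1}^{K} π_t(ω)^r · F(φ(r))(x) = ∑_{r=1}^{K̃} π_t(ω̃)^r · F(ψ(r))(x). Then K = K̃ and there exist a bijection σ : Fin K → Fin K̃ and a vector Δ = (Δ_1, Δ_0) ∈ ℝ² such that for every r, ψ(σ(r)) = φ(r), ω^r_1 = ω̃^{σ(r)}_1 + Δ_1 and ω^r_0 = ω̃^{σ(r)}_0 + Δ_0. In other words, the mixture representation is identifiable up to a permutation of the components and a common translation of the weight parameters. -/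

import Mathlib

open Finset

/-- Time-varying softmax weights: for parameters `ω r = (ω^r_1, ω^r_0) ∈ ℝ²`
and time `t ∈ ℝ`,
`π_t(ω)^r = exp(ω^r_1 · t + ω^r_0) / ∑ j, exp(ω^j_1 · t + ω^j_0)`. -/
noncomputable def timeVaryingWeight {K : ℕ} (ω : Fin K → ℝ × ℝ) (t : ℝ)
    (r : Fin K) : ℝ :=
  Real.exp ((ω r).1 * t + (ω r).2) / ∑ j, Real.exp ((ω j).1 * t + (ω j).2)

theorem timeVaryingWeight_pos {K : ℕ} (ω : Fin K → ℝ × ℝ) (t : ℝ) (r : Fin K) :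
    0 < timeVaryingWeight ω t r :=
  div_pos (Real.exp_pos _) (sum_pos (fun _ _ => Real.exp_pos _) ⟨r, mem_univ r⟩)

theorem log_timeVaryingWeight {K : ℕ} (ω : Fin K → ℝ × ℝ) (t : ℝ) (r : Fin K) :
    Real.log (timeVaryingWeight ω t r) =
      (ω r).1 * t + (ω r).2 - Real.log (∑ j, Real.exp ((ω j).1 * t + (ω j).2)) := by
  rw [timeVaryingWeight, Real.log_div (Real.exp_ne_zero _)
    (sum_pos (fun _ _ => Real.exp_pos _) ⟨r, mem_univ r⟩).ne', Real.log_exp]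

/-- Two linear combinations of distinct members of a linearly independent family that agree
have the same nonzero coefficients. -/
theorem LinearIndependent.exists_eq_of_sum_smul_eq {R M ι α β : Type*} [Ring R]
    [AddCommGroup M] [Module R M] [Fintype α] [Fintype β] {v : ι → M}
    (hv : LinearIndependent R v) {φ : α → ι} {ψ : β → ι}
    (hφ : Function.Injective φ) (hψ : Function.Injective ψ) {a : α → R} {b : β → R}
    (h : ∑ i, a i • v (φ i) = ∑ j, b j • v (ψ j)) {i : α} (hi : a i ≠ 0) :
    ∃ j, ψ j = φ i ∧ b j = a i := by
  have key : (Finsupp.equivFunOnFinite.symm a).mapDomain φ =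
      (Finsupp.equivFunOnFinite.symm b).mapDomain ψ := by
    apply hv
    rw [Finsupp.linearCombination_mapDomain, Finsupp.linearCombination_mapDomain,
      Finsupp.linearCombination_apply, Finsupp.linearCombination_apply]
    simpa [Finsupp.sum_fintype] using h
  have hval := DFunLike.congr_fun key (φ i)
  rw [Finsupp.mapDomain_apply hφ] at hval
  by_cases hmem : φ i ∈ Set.range ψ
  · obtain ⟨j, hj⟩ := hmem
    rw [← hj, Finsupp.mapDomain_apply hψ] at hval
    exact ⟨j, hj, hval.symm⟩
  · rw [Finsupp.mapDomain_of_notMem_range _ _ hmem] at hval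
    exact absurd hval hi

/-- Abstract core of the paper's Theorem 3 (identifiability of the mixture of
identifiable temporal causal models): if the family `F : ι → (X → ℝ)` is
linearly independent over `ℝ`, `φ` and `ψ` are injective selections of
components, and the two softmax-weighted mixtures agree for every time `t` in
a set `T ⊆ ℝ` containing at least two distinct points and every `x`, then the
numbers of components agree and the representation is identifiable up to a
permutation `σ` of the components and a common translation `Δ = (Δ₁, Δ₀) ∈ ℝ²`
of the weight parameters. -/
theorem mixture_identifiable_up_to_permutation_and_translation
    {X ι : Type*} (F : ι → X → ℝ)
    (hF : LinearIndependent ℝ F)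
    {K K' : ℕ} (φ : Fin K → ι) (ψ : Fin K' → ι)
    (hφ : Function.Injective φ) (hψ : Function.Injective ψ)
    (ω : Fin K → ℝ × ℝ) (ω' : Fin K' → ℝ × ℝ)
    (T : Set ℝ) (s t : ℝ) (hs : s ∈ T) (ht : t ∈ T) (hst : s ≠ t)
    (heq : ∀ u ∈ T, ∀ x : X,
      ∑ r, timeVaryingWeight ω u r * F (φ r) x
        = ∑ r, timeVaryingWeight ω' u r * F (ψ r) x) :
    K = K' ∧ ∃ σ : Fin K ≃ Fin K', ∃ Δ : ℝ × ℝ, ∀ r,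
      ψ (σ r) = φ r ∧
      (ω r).1 = (ω' (σ r)).1 + Δ.1 ∧
      (ω r).2 = (ω' (σ r)).2 + Δ.2 := by
  have hsum : ∀ u ∈ T, ∑ r, timeVaryingWeight ω u r • F (φ r) =
      ∑ r, timeVaryingWeight ω' u r • F (ψ r) := fun u hu => by
    ext x
    simpa using heq u hu x
  have hfwd : ∀ u ∈ T, ∀ r, ∃ r', ψ r' = φ r ∧
      timeVaryingWeight ω' u r' = timeVaryingWeight ω u r := fun u hu r =>
    hF.exists_eq_of_sum_smul_eq hφ hψ (hsum u hu) (timeVaryingWeight_pos ω u r).ne'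
  have hbwd : ∀ r', ∃ r, φ r = ψ r' ∧
      timeVaryingWeight ω s r = timeVaryingWeight ω' s r' := fun r' =>
    hF.exists_eq_of_sum_smul_eq hψ hφ (hsum s hs).symm (timeVaryingWeight_pos ω' s r').ne'
  choose f hf _ using hfwd s hs
  choose g hg _ using hbwd
  let σ : Fin K ≃ Fin K' :=
    ⟨f, g, fun r => hφ (by rw [hg, hf]), fun r' => hψ (by rw [hf, hg])⟩
  let c : ℝ → ℝ := fun u => Real.log (∑ j, Real.exp ((ω j).1 * u + (ω j).2)) -
    Real.log (∑ j, Real.exp ((ω' j).1 * u + (ω' j).2))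
  have hc : ∀ u ∈ T, ∀ r,
      ((ω r).1 - (ω' (σ r)).1) * u + ((ω r).2 - (ω' (σ r)).2) = c u := fun u hu r => by
    obtain ⟨r', hr', hw⟩ := hfwd u hu r
    obtain rfl : r' = σ r := hψ (hr'.trans (hf r).symm)
    have hlog := congrArg Real.log hw
    rw [log_timeVaryingWeight, log_timeVaryingWeight] at hlog
    simp only [c]
    linarith
  refine ⟨by simpa using Fintype.card_congr σ, σ,
    ((c s - c t) / (s - t), c s - (c s - c t) / (s - t) * s), fun r => ?_⟩
  have hslope : (c s - c t) / (s - t) = (ω r).1 - (ω' (σ r)).1 := by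
    rw [div_eq_iff (sub_ne_zero.mpr hst), ← hc s hs r, ← hc t ht r]
    ring
  refine ⟨hf r, ?_, ?_⟩
  · simp only [hslope]
    ring
  · simp only [hslope]
    linarith [hc s hs r]
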